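/- Let θ ∈ ℝ, σ > 0, ν > 0 and t > 0. Let Z be a standard Gaussian random variable and let G be a Gamma(t/ν, 1/ν) distributed random variable independent of Z (so G has mean t and variance νt). Then the characteristic function of X = θG + σ√G · Z (the marginal of the Variance Gamma process at time t) is ψ_X(u) = (1 − iθνu + (σ²/2)νu²)^{−t/ν} for all real u, where the complex power is the principal branch. -/

import Mathlib

open MeasureTheory ProbabilityTheory Complex

lemma measurable_gammaPDF (a r : ℝ) : Measurable (gammaPDF a r) :=
  (measurable_gammaPDFReal a r).ennreal_ofReal

/-- The moment generating function of the Gamma distribution, left of its singularity. -/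
lemma mgf_id_gammaMeasure {a r s : ℝ} (ha : 0 < a) (hr : 0 < r) (hs : s < r) :
    mgf id (gammaMeasure a r) s = (1 - s / r) ^ (-a) := by
  have hrs : 0 < r - s := sub_pos.2 hs
  have hΓ : Real.Gamma a ≠ 0 := (Real.Gamma_pos_of_pos ha).ne'
  have hsub : Set.EqOn
      (fun x ↦ (gammaPDF a r x).toReal • Real.exp (s * id x))
      (fun x ↦ r ^ a / Real.Gamma a * (x ^ (a - 1) * Real.exp (-((r - s) * x)))) (Set.Ioi 0) := by
    intro x hx
    have hexp : Real.exp (-((r - s) * x)) = Real.exp (-(r * x)) * Real.exp (s * x) := by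
      rw [← Real.exp_add]
      ring_nf
    simp only [gammaPDF, ENNReal.toReal_ofReal (gammaPDFReal_nonneg ha hr x), smul_eq_mul, id_eq,
      hexp]
    rw [gammaPDFReal, if_pos (Set.mem_Ioi.1 hx).le]
    ring
  rw [mgf, gammaMeasure, integral_withDensity_eq_integral_toReal_smul
    (measurable_gammaPDF a r) (by simp [gammaPDF]),
    ← setIntegral_eq_integral_of_forall_compl_eq_zero (s := Set.Ici 0)
      (fun x hx ↦ by simp [gammaPDF_of_neg (not_le.1 hx)]),
    integral_Ici_eq_integral_Ioi, setIntegral_congr_fun measurableSet_Ioi hsub,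
    integral_const_mul, Real.integral_rpow_mul_exp_neg_mul_Ioi ha hrs,
    one_sub_div hr.ne', Real.rpow_neg (by positivity), Real.div_rpow hrs.le hr.le,
    Real.div_rpow zero_le_one hrs.le, Real.one_rpow]
  field_simp

lemma Iio_subset_integrableExpSet_gammaMeasure {a r : ℝ} (ha : 0 < a) (hr : 0 < r) :
    Set.Iio r ⊆ integrableExpSet id (gammaMeasure a r) := by
  intro s hs
  by_contra h
  have hpos : 0 < (1 - s / r) ^ (-a) :=
    Real.rpow_pos_of_pos (sub_pos.2 ((div_lt_one hr).2 hs)) _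
  rw [← mgf_id_gammaMeasure ha hr hs, mgf, integral_undef h] at hpos
  exact hpos.false

/-- The complex moment generating function of the Gamma distribution. -/
lemma complexMGF_id_gammaMeasure {a r : ℝ} {z : ℂ} (ha : 0 < a) (hr : 0 < r) (hz : z.re < r) :
    complexMGF id (gammaMeasure a r) z = (1 - z / r) ^ (-a : ℂ) := by
  have hconv : Convex ℝ {w : ℂ | w.re < r} := convex_halfSpace_re_lt r
  have hf : AnalyticOnNhd ℂ (complexMGF id (gammaMeasure a r)) {w : ℂ | w.re < r} := fun w hw ↦
    analyticAt_complexMGF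
      (interior_maximal (Iio_subset_integrableExpSet_gammaMeasure ha hr) isOpen_Iio hw)
  have hg : AnalyticOnNhd ℂ (fun w : ℂ ↦ (1 - w / r) ^ (-a : ℂ)) {w : ℂ | w.re < r} := by
    intro w hw
    refine AnalyticAt.cpow (by fun_prop) (by fun_prop) (Or.inl ?_)
    simpa [div_ofReal_re] using (div_lt_one hr).2 hw
  refine hf.eqOn_of_preconnected_of_frequently_eq hg hconv.isPreconnected
    (z₀ := 0) (by simpa using hr) ?_ hz
  have hreal : ∃ᶠ x : ℝ in nhdsWithin 0 {0}ᶜ,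
      complexMGF id (gammaMeasure a r) x = (1 - (x : ℂ) / r) ^ (-a : ℂ) := by
    refine Filter.Eventually.frequently ?_
    filter_upwards [nhdsWithin_le_nhds (Iio_mem_nhds hr)] with x hx
    rw [complexMGF_ofReal, mgf_id_gammaMeasure ha hr hx,
      ofReal_cpow (sub_pos.2 ((div_lt_one hr).2 hx)).le]
    push_cast
    rfl
  have htend : Filter.Tendsto ((↑) : ℝ → ℂ) (nhdsWithin 0 {0}ᶜ) (nhdsWithin 0 {0}ᶜ) := by
    refine tendsto_nhdsWithin_iff.2 ⟨?_, ?_⟩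
    · exact (continuous_ofReal.tendsto' 0 0 ofReal_zero).mono_left nhdsWithin_le_nhds
    · filter_upwards [self_mem_nhdsWithin] with x hx
      simpa using hx
  exact htend.frequently hreal

/-- The characteristic function of the Variance Gamma process marginal
`X = θG + σ√G ⬝ Z` at time `t`, where `G ~ Gamma(t/ν, 1/ν)` is independent of the standard
Gaussian `Z`, is `u ↦ (1 - iθνu + (σ²/2)νu²)^(-t/ν)` (principal branch). -/
theorem charFun_varianceGammaProcess
    {Ω : Type*} [MeasurableSpace Ω] (P : Measure Ω) [IsProbabilityMeasure P]
    (θ σ ν t : ℝ) (hσ : 0 < σ) (hν : 0 < ν) (ht : 0 < t)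
    (G Z : Ω → ℝ) (hGm : Measurable G) (hZm : Measurable Z)
    (hG : Measure.map G P = gammaMeasure (t / ν) (1 / ν))
    (hZ : Measure.map Z P = gaussianReal 0 1)
    (hindep : IndepFun G Z P) (u : ℝ) :
    ∫ ω, Complex.exp (Complex.I * u * (θ * G ω + σ * Real.sqrt (G ω) * Z ω)) ∂P
      = ((1 : ℂ) - Complex.I * θ * ν * u + σ ^ 2 / 2 * ν * u ^ 2) ^ (-(t / ν : ℂ)) := by
  have hshape : 0 < t / ν := div_pos ht hν
  have hrate : 0 < 1 / ν := one_div_pos.2 hν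
  have := isProbabilityMeasure_gammaMeasure hshape hrate
  have hmap : Measure.map (fun ω ↦ (G ω, Z ω)) P
      = (gammaMeasure (t / ν) (1 / ν)).prod (gaussianReal 0 1) := by
    rw [(indepFun_iff_map_prod_eq_prod_map_map hGm.aemeasurable hZm.aemeasurable).1 hindep, hG, hZ]
  let F : ℝ × ℝ → ℂ := fun p ↦ cexp (I * u * (θ * p.1 + σ * Real.sqrt p.1 * p.2))
  have hF : Measurable F := by fun_prop
  have hnorm : ∀ p, ‖F p‖ = 1 := fun p ↦ by
    have : I * u * (θ * p.1 + σ * Real.sqrt p.1 * p.2)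
        = ((u * (θ * p.1 + σ * Real.sqrt p.1 * p.2) : ℝ) : ℂ) * I := by
      push_cast
      ring
    simp only [F, this, norm_exp_ofReal_mul_I]
  have hint : Integrable F ((gammaMeasure (t / ν) (1 / ν)).prod (gaussianReal 0 1)) :=
    .of_bound hF.aestronglyMeasurable 1 (.of_forall fun p ↦ (hnorm p).le)
  have hpos : ∀ᵐ x ∂gammaMeasure (t / ν) (1 / ν), 0 ≤ x := by
    rw [gammaMeasure, ae_withDensity_iff (measurable_gammaPDF _ _)]
    exact .of_forall fun x hx ↦ not_lt.1 fun h ↦ hx (gammaPDF_of_neg h)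
  let z : ℂ := I * u * θ - σ ^ 2 * u ^ 2 / 2
  have hinner : ∀ x : ℝ, 0 ≤ x → ∫ y, F (x, y) ∂gaussianReal 0 1 = cexp (z * x) := by
    intro x hx
    have hsqrt : ((Real.sqrt x : ℝ) : ℂ) ^ 2 = x := by
      rw [← ofReal_pow, Real.sq_sqrt hx]
    have hsplit : ∀ y : ℝ, F (x, y)
        = cexp (I * u * θ * x) * cexp ((u * σ * Real.sqrt x : ℝ) * y * I) := fun y ↦ by
      rw [← Complex.exp_add]
      simp only [F]
      push_cast
      ring_nf
    simp_rw [hsplit]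
    rw [integral_const_mul, ← charFun_apply_real, charFun_gaussianReal, ← Complex.exp_add]
    congr 1
    push_cast
    simp only [z, mul_pow, hsqrt]
    ring
  have hzre : z.re < 1 / ν := by
    have : z.re = -(σ ^ 2 * u ^ 2 / 2) := by
      have : z = ((-(σ ^ 2 * u ^ 2 / 2) : ℝ) : ℂ) + ((u * θ : ℝ) : ℂ) * I := by
        simp only [z]
        push_cast
        ring
      simp [this, -ofReal_neg, -ofReal_mul]
    rw [this]
    have : 0 ≤ σ ^ 2 * u ^ 2 / 2 := by positivity
    linarith
  calc
    _ = ∫ p, F p ∂(gammaMeasure (t / ν) (1 / ν)).prod (gaussianReal 0 1) := by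
      rw [← hmap, integral_map (by fun_prop) hF.aestronglyMeasurable]
    _ = ∫ x, cexp (z * x) ∂gammaMeasure (t / ν) (1 / ν) := by
      rw [integral_prod _ hint]
      exact integral_congr_ae (hpos.mono hinner)
    _ = (1 - z / (1 / ν : ℝ)) ^ (-(t / ν : ℝ) : ℂ) :=
      complexMGF_id_gammaMeasure hshape hrate hzre
    _ = _ := by
      have hν' : (ν : ℂ) ≠ 0 := ofReal_ne_zero.2 hν.ne'
      push_cast
      congr 1
      simp only [z]
      field_simp
      ring
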